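/- arXiv:1706.10228 — 3 statements merged into one kernel-verified Lean document; each statement's English description precedes it below -/
import Mathlib

section
/- Let G be a simple graph and let R be a family of pieces of G. For any two distinct pieces P_i, P_j ∈ R, every walk in G from a vertex of P_i to a vertex of P_j contains a vertex of ∂R. -/
/-- The boundary `∂P` of a piece `P` of `G`: the set of vertices of `P` that are
incident in `G` to an edge not belonging to `P`. -/
def SimpleGraph.pieceBoundary {V : Type*} (G : SimpleGraph V) (P : G.Subgraph) : Set V :=
  {v | v ∈ P.verts ∧ ∃ w, G.Adj v w ∧ ¬ P.Adj v w}

/-- Let `G` be a simple graph and let `R = (P l)_{l : ι}` be a family of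
pieces of `G` (pairwise edge-disjoint subgraphs without isolated vertices whose union
contains every edge of `G`). For any two distinct pieces `P i, P j`, every walk in `G`
from a vertex of `P i` to a vertex of `P j` contains a vertex of `∂R = ⋃ l, ∂(P l)`. -/
theorem stmt_1 {V : Type*} {ι : Type*} (G : SimpleGraph V) (P : ι → G.Subgraph)
    (hiso : ∀ l, ∀ v ∈ (P l).verts, ∃ w, (P l).Adj v w)
    (hdisj : ∀ l l', l ≠ l' → ∀ u v, (P l).Adj u v → ¬ (P l').Adj u v)
    (hcover : ∀ u v, G.Adj u v → ∃ l, (P l).Adj u v)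
    (i j : ι) (hij : i ≠ j) (x y : V)
    (hx : x ∈ (P i).verts) (hy : y ∈ (P j).verts) (p : G.Walk x y) :
    ∃ b ∈ p.support, b ∈ ⋃ l, G.pieceBoundary (P l) := by
  induction p with
  | nil =>
    obtain ⟨w, hw⟩ := hiso j _ hy
    exact ⟨_, by simp, Set.mem_iUnion.2
      ⟨i, hx, w, hw.adj_sub, hdisj j i hij.symm _ _ hw⟩⟩
  | @cons u v _ h q ih =>
    by_cases hP : (P i).Adj u v
    · obtain ⟨b, hb, hbR⟩ := ih hP.snd_mem hy
      exact ⟨b, by simp [hb], hbR⟩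
    · exact ⟨u, by simp, Set.mem_iUnion.2 ⟨i, hx, v, h, hP⟩⟩
end

section
/- Let G₀ be a simple graph, let R be a family of pieces of G₀, and let φ : V(G₀) → V be a map such that for every v ∈ V the preimage φ⁻¹(v) induces a connected subgraph of G₀. Then for any two distinct pieces P_i, P_j ∈ R, the intersection φ(V(P_i)) ∩ φ(V(P_j)) is contained in φ(∂R). -/
/-- A subgraph meeting a connected set of vertices which avoids its boundary contains that set. -/
theorem SimpleGraph.mem_verts_of_disjoint_pieceBoundary {V : Type*} {G : SimpleGraph V}
    {P : G.Subgraph} {s : Set V} (hs : Disjoint s (G.pieceBoundary P)) {x y : s}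
    (hxy : (G.induce s).Reachable x y) (hx : (x : V) ∈ P.verts) : (y : V) ∈ P.verts := by
  obtain ⟨p⟩ := hxy
  induction p with
  | nil => exact hx
  | @cons u v _ huv _ ih =>
    refine ih (SimpleGraph.Subgraph.Adj.snd_mem (H := P) (u := u) ?_)
    by_contra h
    exact Set.disjoint_left.mp hs u.2 ⟨hx, v, huv, h⟩

/-- Let `G₀` be a simple graph, let `R = (P l)_{l : ι}` be a family of
pieces of `G₀` (pairwise edge-disjoint subgraphs without isolated vertices whose union
contains every edge of `G₀`), and let `φ : V(G₀) → V` be a map such that for every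
`v ∈ V` the preimage `φ⁻¹(v)` induces a connected subgraph of `G₀`. Then for any two
distinct pieces `P i, P j`, the intersection `φ(V(P i)) ∩ φ(V(P j))` is contained in
`φ(∂R)`. -/
theorem stmt_2 {V₀ V : Type*} {ι : Type*} (G₀ : SimpleGraph V₀) (P : ι → G₀.Subgraph)
    (hiso : ∀ l, ∀ v ∈ (P l).verts, ∃ w, (P l).Adj v w)
    (hdisj : ∀ l l', l ≠ l' → ∀ u v, (P l).Adj u v → ¬ (P l').Adj u v)
    (hcover : ∀ u v, G₀.Adj u v → ∃ l, (P l).Adj u v)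
    (φ : V₀ → V)
    (hconn : ∀ v : V, (G₀.induce (φ ⁻¹' {v})).Connected)
    (i j : ι) (hij : i ≠ j) :
    φ '' (P i).verts ∩ φ '' (P j).verts ⊆ φ '' (⋃ l, G₀.pieceBoundary (P l)) := by
  rintro v ⟨⟨a, ha, hav⟩, b, hb, hbv⟩
  by_contra hv
  have hfiber : Disjoint (φ ⁻¹' {v}) (G₀.pieceBoundary (P i)) :=
    Set.disjoint_left.mpr fun x hx hxP => hv ⟨x, Set.mem_iUnion.mpr ⟨i, hxP⟩, hx⟩
  have hbi : b ∈ (P i).verts := SimpleGraph.mem_verts_of_disjoint_pieceBoundary hfiber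
    ((hconn v).preconnected ⟨a, hav⟩ ⟨b, hbv⟩) ha
  obtain ⟨w, hw⟩ := hiso j b hb
  exact Set.disjoint_left.mp hfiber hbv ⟨hbi, w, hw.adj_sub, hdisj j i hij.symm b w hw⟩
end

section
/- Let G be a simple graph, let S be a set of vertices of G such that the set C of edges of G with exactly one endpoint in S satisfies |C| ≤ k, and let e ∈ C. Then a subgraph H of G is a (k+1)-edge-connected subgraph of G if and only if H is a (k+1)-edge-connected subgraph of the graph obtained from G by deleting e; in particular the maximal (k+1)-edge-connected subgraphs of G and of G − e coincide. -/
/-- A subgraph `H` of `G` is `(k+1)`-edge-connected if it is connected and, for every set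
`F` of at most `k` of its edges, `H` with `F` deleted is connected. -/
def SimpleGraph.Subgraph.KPlusOneEdgeConnected {V : Type*} {G : SimpleGraph V}
    (k : ℕ) (H : G.Subgraph) : Prop :=
  H.Connected ∧ ∀ F : Finset (Sym2 V), ↑F ⊆ H.edgeSet → F.card ≤ k →
    (H.deleteEdges ↑F).Connected

/-- A `(k+1)`-edge-connected subgraph contains no edge of an edge cut of size at most `k`. -/
theorem SimpleGraph.Subgraph.KPlusOneEdgeConnected.notMem_edgeSet_of_mem_cut {V : Type*}
    {G : SimpleGraph V} {k : ℕ} {H : G.Subgraph} (hH : H.KPlusOneEdgeConnected k)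
    {S : Set V} {C : Set (Sym2 V)}
    (hC : C = {e' | e' ∈ G.edgeSet ∧ ∃ a b, e' = s(a, b) ∧ a ∈ S ∧ b ∉ S})
    (hCfin : C.Finite) (hCk : C.ncard ≤ k) {e : Sym2 V} (he : e ∈ C) :
    e ∉ H.edgeSet := by
  intro heH
  have hfin : (C ∩ H.edgeSet).Finite := hCfin.inter_of_left _
  have hcard : hfin.toFinset.card ≤ k := by
    rw [← Set.ncard_eq_toFinset_card _ hfin]
    exact (Set.ncard_le_ncard Set.inter_subset_left hCfin).trans hCk
  have hconn := hH.2 hfin.toFinset (by simp) hcard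
  subst hC
  obtain ⟨-, a, b, rfl, ha, hb⟩ := he
  rw [SimpleGraph.Subgraph.mem_edgeSet] at heH
  obtain ⟨p⟩ := hconn.coe.preconnected ⟨a, H.edge_vert heH⟩ ⟨b, H.edge_vert heH.symm⟩
  obtain ⟨d, -, hd₁, hd₂⟩ := p.exists_boundary_dart (Subtype.val ⁻¹' S) ha hb
  have hadj := d.adj
  rw [SimpleGraph.Subgraph.coe_adj, SimpleGraph.Subgraph.deleteEdges_adj] at hadj
  exact hadj.2 <| hfin.mem_toFinset.2 ⟨⟨hadj.1.adj_sub, _, _, rfl, hd₁, hd₂⟩, hadj.1⟩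

/-- Let `G` be a simple graph, let `S` be a set of vertices of `G` such
that the set `C` of edges of `G` with exactly one endpoint in `S` satisfies `|C| ≤ k`, and
let `e ∈ C`. Then a subgraph `H` of `G` is a `(k+1)`-edge-connected subgraph of `G` if and
only if `H` is a `(k+1)`-edge-connected subgraph of the graph obtained from `G` by
deleting `e` (i.e. a `(k+1)`-edge-connected subgraph of `G` avoiding the edge `e`); in
particular the maximal `(k+1)`-edge-connected subgraphs of `G` and of `G − e` coincide. -/
theorem stmt_10 {V : Type*} (G : SimpleGraph V) (S : Set V) (k : ℕ)
    (C : Set (Sym2 V))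
    (hC : C = {e' | e' ∈ G.edgeSet ∧ ∃ a b, e' = s(a, b) ∧ a ∈ S ∧ b ∉ S})
    (hCfin : C.Finite) (hCk : C.ncard ≤ k)
    (e : Sym2 V) (he : e ∈ C) :
    (∀ H : G.Subgraph, H.KPlusOneEdgeConnected k ↔
        (e ∉ H.edgeSet ∧ H.KPlusOneEdgeConnected k)) ∧
    {H : G.Subgraph | H.KPlusOneEdgeConnected k ∧
        ∀ H' : G.Subgraph, H'.KPlusOneEdgeConnected k → H ≤ H' → H = H'}
      = {H : G.Subgraph | (e ∉ H.edgeSet ∧ H.KPlusOneEdgeConnected k) ∧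
        ∀ H' : G.Subgraph, (e ∉ H'.edgeSet ∧ H'.KPlusOneEdgeConnected k) → H ≤ H' → H = H'} := by
  have key : ∀ H : G.Subgraph, H.KPlusOneEdgeConnected k ↔
      (e ∉ H.edgeSet ∧ H.KPlusOneEdgeConnected k) := fun H =>
    ⟨fun h => ⟨h.notMem_edgeSet_of_mem_cut hC hCfin hCk he, h⟩, And.right⟩
  refine ⟨key, ?_⟩
  simp only [← key]
end
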